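/- (Convex gradient mLSI for the multislice.) For every convex function f : [x_1, x_L]^N → ℝ, Ent_{P_κ}(e^f) ≤ 4 |𝒳|² · E_κ[ e^f |∇f|² ], where |∇f| is the Euclidean norm of the gradient of f; i.e. P_κ satisfies a ∇-mLSI with σ² = 8|𝒳|² on the class of convex functions. -/

import Mathlib

open Finset Real
open scoped Classical

noncomputable section

/-- The multislice `Ω_κ ⊆ 𝒳^N`: vectors with values in `{x ℓ}` where the value `x ℓ`
appears exactly `κ ℓ` times. -/
def multislice (L N : ℕ) (κ : Fin L → ℕ) (x : Fin L → ℝ) : Finset (Fin N → ℝ) :=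
  (Fintype.piFinset fun _ : Fin N => Finset.image x Finset.univ).filter
    (fun ω => ∀ ℓ : Fin L, (Finset.univ.filter fun i => ω i = x ℓ).card = κ ℓ)

/-- Expectation with respect to the uniform distribution on a finite set. -/
def uexpect {α : Type*} (Ω : Finset α) (f : α → ℝ) : ℝ := (∑ ω ∈ Ω, f ω) / Ω.card

/-- Probability of an event with respect to the uniform distribution on a finite set. -/
def uprob {α : Type*} (Ω : Finset α) (p : α → Prop) : ℝ :=
  ((Ω.filter p).card : ℝ) / Ω.card

/-- The entropy functional `Ent_μ(g) = E_μ[g log g] − (E_μ g) log (E_μ g)` with respect to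
the uniform distribution on a finite set. -/
def uent {α : Type*} (Ω : Finset α) (g : α → ℝ) : ℝ :=
  uexpect Ω (fun ω => g ω * Real.log (g ω)) - uexpect Ω g * Real.log (uexpect Ω g)

/-- `Γ(f)² (ω) = (1/(2N)) ∑_{i<j} (f(ω) − f(τ_ij ω))²`. -/
def gammaSq {N : ℕ} (f : (Fin N → ℝ) → ℝ) (ω : Fin N → ℝ) : ℝ :=
  (1 / (2 * (N : ℝ))) * ∑ q ∈ (Finset.univ : Finset (Fin N × Fin N)).filter
    (fun q => q.1 < q.2), (f ω - f (ω ∘ Equiv.swap q.1 q.2)) ^ 2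

/-- `Γ⁺(f)² (ω) = (1/(2N)) ∑_{i<j} ((f(ω) − f(τ_ij ω))₊)²`. -/
def gammaPlusSq {N : ℕ} (f : (Fin N → ℝ) → ℝ) (ω : Fin N → ℝ) : ℝ :=
  (1 / (2 * (N : ℝ))) * ∑ q ∈ (Finset.univ : Finset (Fin N × Fin N)).filter
    (fun q => q.1 < q.2), (max (f ω - f (ω ∘ Equiv.swap q.1 q.2)) 0) ^ 2

/-- The integrand `(u − v)(log u − log v)` of the modified log-Sobolev Dirichlet form. -/
def logDiffProd (u v : ℝ) : ℝ := (u - v) * (Real.log u - Real.log v)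

/-- The Dirichlet form of a function of a permutation in the direction of the position
transposition `(a b)`. -/
def swapForm {n : ℕ} (g : Equiv.Perm (Fin n) → ℝ) (a b : Fin n) : ℝ :=
  ∑ σ, logDiffProd (g σ) (g (σ * Equiv.swap a b))

theorem logDiffProd_comm (u v : ℝ) : logDiffProd u v = logDiffProd v u := by
  unfold logDiffProd; ring

theorem logDiffProd_self (u : ℝ) : logDiffProd u u = 0 := by
  simp [logDiffProd]

theorem log_sum_inequality {ι : Type*} (s : Finset ι) (a b : ι → ℝ)
    (ha : ∀ i ∈ s, 0 < a i) (hb : ∀ i ∈ s, 0 < b i) :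
    (∑ i ∈ s, a i) * (Real.log (∑ i ∈ s, a i) - Real.log (∑ i ∈ s, b i)) ≤
      ∑ i ∈ s, a i * (Real.log (a i) - Real.log (b i)) := by
  rcases s.eq_empty_or_nonempty with rfl | hs
  · simp
  set A := ∑ i ∈ s, a i with hA
  set B := ∑ i ∈ s, b i with hB
  have hApos : 0 < A := Finset.sum_pos ha hs
  have hBpos : 0 < B := Finset.sum_pos hb hs
  have key : ∀ i ∈ s, a i - b i * (A / B) ≤
      a i * (Real.log (a i) - Real.log (b i)) - a i * (Real.log A - Real.log B) := by
    intro i hi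
    have h1 := ha i hi
    have h2 := hb i hi
    have hlog := Real.log_le_sub_one_of_pos (show 0 < b i * A / (a i * B) by positivity)
    rw [Real.log_div (by positivity) (by positivity), Real.log_mul h2.ne' hApos.ne',
      Real.log_mul h1.ne' hBpos.ne'] at hlog
    have hmul := mul_le_mul_of_nonneg_left hlog h1.le
    have heq : a i * (b i * A / (a i * B) - 1) = b i * (A / B) - a i := by
      field_simp
    rw [heq] at hmul
    linarith
  have hsum := Finset.sum_le_sum key
  rw [Finset.sum_sub_distrib, Finset.sum_sub_distrib, ← Finset.sum_mul, ← Finset.sum_mul,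
    ← hA, ← hB, mul_div_cancel₀ _ hBpos.ne', sub_self] at hsum
  linarith

theorem logDiffProd_sum_le {ι : Type*} (s : Finset ι) (a b : ι → ℝ)
    (ha : ∀ i ∈ s, 0 < a i) (hb : ∀ i ∈ s, 0 < b i) :
    logDiffProd (∑ i ∈ s, a i) (∑ i ∈ s, b i) ≤ ∑ i ∈ s, logDiffProd (a i) (b i) := by
  have h1 := log_sum_inequality s a b ha hb
  have h2 := log_sum_inequality s b a hb ha
  have h3 : ∑ i ∈ s, logDiffProd (a i) (b i) =
      ∑ i ∈ s, a i * (Real.log (a i) - Real.log (b i)) +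
        ∑ i ∈ s, b i * (Real.log (b i) - Real.log (a i)) := by
    rw [← Finset.sum_add_distrib]
    exact Finset.sum_congr rfl fun i _ => by unfold logDiffProd; ring
  rw [h3]
  unfold logDiffProd
  linarith

/-- Modified log-Sobolev inequality for the uniform measure on a finite set, with respect to
complete resampling. -/
theorem entropy_le_logDiffProd {ι : Type*} [Fintype ι] [Nonempty ι] (h : ι → ℝ)
    (hpos : ∀ i, 0 < h i) :
    ∑ i, h i * Real.log (h i) - (∑ i, h i) * Real.log ((∑ i, h i) / Fintype.card ι) ≤
      1 / (2 * (Fintype.card ι : ℝ)) * ∑ i, ∑ j, logDiffProd (h i) (h j) := by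
  set m : ℝ := (Fintype.card ι : ℝ) with hm
  have hmpos : 0 < m := by rw [hm]; exact_mod_cast Fintype.card_pos
  set H := ∑ i, h i with hH
  have hHpos : 0 < H := Finset.sum_pos (fun i _ => hpos i) Finset.univ_nonempty
  have hdiv : 0 < H / m := by positivity
  have hjensen : ∑ i, Real.log (h i) ≤ m * Real.log (H / m) := by
    have key : ∀ i ∈ (Finset.univ : Finset ι),
        Real.log (h i) - Real.log (H / m) ≤ h i / (H / m) - 1 := fun i _ => by
      rw [← Real.log_div (hpos i).ne' hdiv.ne']
      exact Real.log_le_sub_one_of_pos (div_pos (hpos i) hdiv)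
    have hsum := Finset.sum_le_sum key
    rw [Finset.sum_sub_distrib, Finset.sum_sub_distrib, ← Finset.sum_div, ← hH] at hsum
    simp only [Finset.sum_const, Finset.card_univ, nsmul_eq_mul, mul_one, ← hm] at hsum
    have : H / (H / m) = m := by field_simp
    rw [this] at hsum
    linarith
  have hform : ∑ i, ∑ j, logDiffProd (h i) (h j) =
      2 * m * ∑ i, h i * Real.log (h i) - 2 * H * ∑ i, Real.log (h i) := by
    have : ∀ i, ∑ j, logDiffProd (h i) (h j) = m * (h i * Real.log (h i)) -
        h i * ∑ j, Real.log (h j) - H * Real.log (h i) + ∑ j, h j * Real.log (h j) := fun i => by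
      have e : ∀ j, logDiffProd (h i) (h j) = h i * Real.log (h i) - h i * Real.log (h j) -
          h j * Real.log (h i) + h j * Real.log (h j) := fun j => by unfold logDiffProd; ring
      simp only [e, Finset.sum_add_distrib, Finset.sum_sub_distrib, ← Finset.mul_sum,
        ← Finset.sum_mul, Finset.sum_const, Finset.card_univ, nsmul_eq_mul, ← hm, ← hH]
      ring
    simp only [this, Finset.sum_add_distrib, Finset.sum_sub_distrib, ← Finset.mul_sum,
        ← Finset.sum_mul, Finset.sum_const, Finset.card_univ, nsmul_eq_mul, ← hm, ← hH]
    ring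
  have hmul := mul_le_mul_of_nonneg_left hjensen hHpos.le
  rw [hform]
  have : 1 / (2 * m) * (2 * m * ∑ i, h i * Real.log (h i) - 2 * H * ∑ i, Real.log (h i)) =
      ∑ i, h i * Real.log (h i) - H * (∑ i, Real.log (h i)) / m := by
    field_simp
  rw [this]
  have : H * (∑ i, Real.log (h i)) / m ≤ H * Real.log (H / m) := by
    rw [div_le_iff₀ hmpos]; linarith
  linarith

theorem decomposeFin_symm_mul_swap {n : ℕ} (p : Fin (n + 1)) (e : Equiv.Perm (Fin n))
    (a b : Fin n) :
    Equiv.Perm.decomposeFin.symm (p, e * Equiv.swap a b) =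
      Equiv.Perm.decomposeFin.symm (p, e) * Equiv.swap a.succ b.succ := by
  ext i
  congr 1
  refine Fin.cases ?_ (fun j => ?_) i
  · rw [Equiv.Perm.mul_apply, Equiv.swap_apply_of_ne_of_ne (Fin.succ_ne_zero a).symm
      (Fin.succ_ne_zero b).symm]
    simp
  · rw [Equiv.Perm.mul_apply, ← (Fin.succ_injective n).map_swap]
    simp

theorem sum_perm_fin_succ {n : ℕ} (F : Equiv.Perm (Fin (n + 1)) → ℝ) :
    ∑ σ, F σ = ∑ p, ∑ e, F (Equiv.Perm.decomposeFin.symm (p, e)) := by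
  rw [← Equiv.sum_comp Equiv.Perm.decomposeFin.symm, Fintype.sum_prod_type]

theorem sum_decomposeFin_symm {n : ℕ} (F : Equiv.Perm (Fin (n + 1)) → ℝ) (p : Fin (n + 1)) :
    ∑ e, F (Equiv.Perm.decomposeFin.symm (p, e)) =
      ∑ σ ∈ Finset.univ.filter (fun σ : Equiv.Perm (Fin (n + 1)) => σ 0 = p), F σ := by
  rw [Finset.sum_filter, sum_perm_fin_succ]
  simp [Finset.sum_ite_irrel]

theorem swapForm_self {n : ℕ} (g : Equiv.Perm (Fin n) → ℝ) (a : Fin n) :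
    swapForm g a a = 0 := by
  unfold swapForm
  refine Finset.sum_eq_zero fun σ _ => ?_
  rw [Equiv.swap_self, ← Equiv.Perm.one_def, mul_one, logDiffProd_self]

theorem swapForm_comm {n : ℕ} (g : Equiv.Perm (Fin n) → ℝ) (a b : Fin n) :
    swapForm g a b = swapForm g b a := by
  simp [swapForm, Equiv.swap_comm a b]

theorem logDiffProd_nonneg {u v : ℝ} (hu : 0 < u) (hv : 0 < v) : 0 ≤ logDiffProd u v := by
  unfold logDiffProd
  rcases le_total u v with h | h
  · exact mul_nonneg_of_nonpos_of_nonpos (sub_nonpos.2 h) (sub_nonpos.2 (Real.log_le_log hu h))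
  · exact mul_nonneg (sub_nonneg.2 h) (sub_nonneg.2 (Real.log_le_log hv h))

theorem swapForm_nonneg {n : ℕ} (g : Equiv.Perm (Fin n) → ℝ) (hg : ∀ σ, 0 < g σ) (a b : Fin n) :
    0 ≤ swapForm g a b :=
  Finset.sum_nonneg fun _ _ => logDiffProd_nonneg (hg _) (hg _)

/-- The Dirichlet form of the law of the image of `0` is controlled by the transpositions
moving `0`. -/
theorem sum_logDiffProd_marginal_le {n : ℕ} (g : Equiv.Perm (Fin (n + 1)) → ℝ)
    (hg : ∀ σ, 0 < g σ) :
    ∑ p, ∑ q, logDiffProd (∑ e, g (Equiv.Perm.decomposeFin.symm (p, e)))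
      (∑ e, g (Equiv.Perm.decomposeFin.symm (q, e))) ≤ ∑ b, swapForm g 0 b := by
  have hshift : ∀ p q, ∑ e, g (Equiv.Perm.decomposeFin.symm (q, e)) =
      ∑ σ ∈ Finset.univ.filter (fun σ : Equiv.Perm (Fin (n + 1)) => σ 0 = p),
        g (Equiv.swap p q * σ) := fun p q => by
    rw [sum_decomposeFin_symm, Finset.sum_filter, Finset.sum_filter,
      ← Equiv.sum_comp (Equiv.mulLeft (Equiv.swap p q))]
    refine Finset.sum_congr rfl fun σ _ => ?_
    have : (Equiv.swap p q) (σ 0) = q ↔ σ 0 = p := by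
      rw [Equiv.swap_apply_eq_iff, Equiv.swap_apply_right]
    simp [this]
  calc _ ≤ ∑ p, ∑ q, ∑ σ ∈ Finset.univ.filter (fun σ : Equiv.Perm (Fin (n + 1)) => σ 0 = p),
          logDiffProd (g σ) (g (Equiv.swap p q * σ)) := by
        refine Finset.sum_le_sum fun p _ => Finset.sum_le_sum fun q _ => ?_
        rw [hshift p q, sum_decomposeFin_symm]
        exact logDiffProd_sum_le _ _ _ (fun _ _ => hg _) (fun _ _ => hg _)
    _ = ∑ σ : Equiv.Perm (Fin (n + 1)), ∑ q, logDiffProd (g σ) (g (Equiv.swap (σ 0) q * σ)) := by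
        simp only [Finset.sum_filter, Finset.sum_comm (s := (Finset.univ : Finset (Fin (n + 1))))
          (t := (Finset.univ : Finset (Equiv.Perm (Fin (n + 1)))))]
        refine Finset.sum_congr rfl fun σ _ => ?_
        rw [Finset.sum_comm]
        simp
    _ = ∑ σ : Equiv.Perm (Fin (n + 1)), ∑ b, logDiffProd (g σ) (g (σ * Equiv.swap 0 b)) := by
        refine Finset.sum_congr rfl fun σ _ => ?_
        rw [← Equiv.sum_comp σ]
        refine Finset.sum_congr rfl fun b _ => ?_
        rw [Equiv.swap_mul_eq_mul_swap]
        simp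
    _ = _ := Finset.sum_comm

theorem swapForm_mul_right {n : ℕ} (g : Equiv.Perm (Fin n) → ℝ) (τ : Equiv.Perm (Fin n))
    (a b : Fin n) : swapForm (fun σ => g (σ * τ)) a b = swapForm g (τ⁻¹ a) (τ⁻¹ b) := by
  unfold swapForm
  conv_rhs => rw [← Equiv.sum_comp (Equiv.mulRight τ)]
  refine Finset.sum_congr rfl fun σ _ => ?_
  simp only [Equiv.coe_mulRight]
  rw [mul_assoc, Equiv.swap_mul_eq_mul_swap, mul_assoc]

/-- The modified log-Sobolev inequality for random transpositions on the symmetric group. -/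
theorem entropy_perm_le_swapForm (n : ℕ) (g : Equiv.Perm (Fin n) → ℝ) (hg : ∀ σ, 0 < g σ) :
    ∑ σ, g σ * Real.log (g σ) - (∑ σ, g σ) * Real.log ((∑ σ, g σ) / n.factorial) ≤
      1 / (2 * (n : ℝ)) * ∑ a, ∑ b, swapForm g a b := by
  induction n with
  | zero => simp
  | succ n ih =>
    have hzero : ∀ g : Equiv.Perm (Fin (n + 1)) → ℝ, (∀ σ, 0 < g σ) →
        ∑ σ, g σ * Real.log (g σ) - (∑ σ, g σ) * Real.log ((∑ σ, g σ) / (n + 1).factorial) ≤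
          1 / (2 * (n : ℝ)) * (∑ a, ∑ b, swapForm g a b - 2 * ∑ b, swapForm g 0 b) +
            1 / (2 * ((n : ℝ) + 1)) * ∑ b, swapForm g 0 b := by
      intro g hg
      set S : Fin (n + 1) → ℝ := fun p => ∑ e, g (Equiv.Perm.decomposeFin.symm (p, e))
      have hSpos : ∀ p, 0 < S p := fun p =>
        Finset.sum_pos (fun _ _ => hg _) Finset.univ_nonempty
      have hcond := Finset.sum_le_sum fun p (_ : p ∈ (Finset.univ : Finset (Fin (n + 1)))) =>
        ih (fun e => g (Equiv.Perm.decomposeFin.symm (p, e))) (fun _ => hg _)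
      have hmarg := entropy_le_logDiffProd S hSpos
      have htotal : ∑ σ, g σ = ∑ p, S p := sum_perm_fin_succ g
      have hTpos : 0 < ∑ p, S p := Finset.sum_pos (fun p _ => hSpos p) Finset.univ_nonempty
      have hfac : (0 : ℝ) < n.factorial := by positivity
      have hform : ∑ p, ∑ a, ∑ b, swapForm
          (fun e => g (Equiv.Perm.decomposeFin.symm (p, e))) a b =
          ∑ a, ∑ b, swapForm g a b - 2 * ∑ b, swapForm g 0 b := by
        have hsucc : ∑ p, ∑ a, ∑ b, swapForm
            (fun e => g (Equiv.Perm.decomposeFin.symm (p, e))) a b =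
            ∑ a : Fin n, ∑ b : Fin n, swapForm g a.succ b.succ := by
          rw [Finset.sum_comm]
          refine Finset.sum_congr rfl fun a _ => ?_
          rw [Finset.sum_comm]
          refine Finset.sum_congr rfl fun b _ => ?_
          unfold swapForm
          rw [sum_perm_fin_succ]
          simp only [decomposeFin_symm_mul_swap]
        rw [hsucc]
        simp only [Fin.sum_univ_succ, swapForm_self, Finset.sum_add_distrib]
        simp only [swapForm_comm g (Fin.succ _) 0]
        ring
      rw [← Finset.mul_sum, hform, Finset.sum_sub_distrib,
        ← sum_perm_fin_succ fun σ => g σ * Real.log (g σ)] at hcond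
      have hmarg' := mul_le_mul_of_nonneg_left (sum_logDiffProd_marginal_le g hg)
        (show (0 : ℝ) ≤ 1 / (2 * ((n : ℝ) + 1)) by positivity)
      simp only [Fintype.card_fin, Nat.cast_add, Nat.cast_one] at hmarg
      have hlog : ∑ p, S p * Real.log (S p / n.factorial) =
          ∑ p, S p * Real.log (S p) - (∑ p, S p) * Real.log n.factorial := by
        rw [Finset.sum_mul, ← Finset.sum_sub_distrib]
        refine Finset.sum_congr rfl fun p _ => ?_
        rw [Real.log_div (hSpos p).ne' hfac.ne']
        ring
      have hlog' : Real.log ((∑ p, S p) / (n + 1).factorial) =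
          Real.log ((∑ p, S p) / ((n : ℝ) + 1)) - Real.log n.factorial := by
        rw [← Real.log_div (by positivity) hfac.ne', Nat.factorial_succ]
        push_cast
        rw [div_div]
      change _ - ∑ p, S p * Real.log (S p / n.factorial) ≤ _ at hcond
      rw [hlog] at hcond
      rw [htotal, hlog']
      linarith
    have hshift : ∀ i : Fin (n + 1),
        ∑ σ, g σ * Real.log (g σ) - (∑ σ, g σ) * Real.log ((∑ σ, g σ) / (n + 1).factorial) ≤
          1 / (2 * (n : ℝ)) * (∑ a, ∑ b, swapForm g a b - 2 * ∑ b, swapForm g i b) +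
            1 / (2 * ((n : ℝ) + 1)) * ∑ b, swapForm g i b := by
      intro i
      have h := hzero (fun σ => g (σ * Equiv.swap 0 i)) (fun _ => hg _)
      have hrow : ∀ c : Fin (n + 1), ∑ b, swapForm g c ((Equiv.swap 0 i)⁻¹ b) =
          ∑ b, swapForm g c b := fun c =>
        Equiv.sum_comp (Equiv.swap 0 i)⁻¹ (fun b => swapForm g c b)
      simp only [swapForm_mul_right, hrow] at h
      have hg_sum := Equiv.sum_comp (Equiv.mulRight (Equiv.swap 0 i)) g
      have hlog_sum := Equiv.sum_comp (Equiv.mulRight (Equiv.swap 0 i))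
        fun σ => g σ * Real.log (g σ)
      simp only [Equiv.coe_mulRight] at hg_sum hlog_sum
      rw [Equiv.sum_comp (Equiv.swap 0 i)⁻¹ (fun a => ∑ b, swapForm g a b), hg_sum,
        hlog_sum] at h
      simpa using h
    have hsum := Finset.sum_le_sum fun i (_ : i ∈ (Finset.univ : Finset (Fin (n + 1)))) =>
      hshift i
    have hD : 0 ≤ ∑ a, ∑ b, swapForm g a b :=
      Finset.sum_nonneg fun a _ => Finset.sum_nonneg fun b _ => swapForm_nonneg g hg a b
    simp only [Finset.sum_const, Finset.card_univ, Fintype.card_fin, nsmul_eq_mul,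
      Finset.sum_add_distrib, ← Finset.mul_sum, Finset.sum_sub_distrib] at hsum
    push_cast at hsum ⊢
    set D := ∑ a, ∑ b, swapForm g a b
    set E := ∑ σ, g σ * Real.log (g σ) -
      (∑ σ, g σ) * Real.log ((∑ σ, g σ) / ((n + 1).factorial : ℝ))
    have hcoef : 1 / (2 * (n : ℝ)) * (((n : ℝ) + 1) * D - 2 * D) +
        1 / (2 * ((n : ℝ) + 1)) * D ≤ D / 2 := by
      rcases Nat.eq_zero_or_pos n with rfl | hn
      · norm_num; linarith
      · have hn' : (0 : ℝ) < n := by exact_mod_cast hn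
        have : D / 2 - (1 / (2 * (n : ℝ)) * (((n : ℝ) + 1) * D - 2 * D) +
            1 / (2 * ((n : ℝ) + 1)) * D) = D / (2 * n * (n + 1)) := by
          field_simp
          ring
        have : 0 ≤ D / (2 * n * ((n : ℝ) + 1)) := by positivity
        linarith
    have hE : E * ((n : ℝ) + 1) ≤ D / 2 := by linarith
    rw [← le_div_iff₀ (by positivity)] at hE
    calc E ≤ D / 2 / ((n : ℝ) + 1) := hE
      _ = _ := by field_simp

theorem comp_perm_mem_multislice {L N : ℕ} {κ : Fin L → ℕ} {x : Fin L → ℝ} {ω : Fin N → ℝ}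
    (hω : ω ∈ multislice L N κ x) (σ : Equiv.Perm (Fin N)) :
    ω ∘ σ ∈ multislice L N κ x := by
  simp only [multislice, Finset.mem_filter, Fintype.mem_piFinset] at hω ⊢
  refine ⟨fun i => hω.1 (σ i), fun ℓ => ?_⟩
  rw [← hω.2 ℓ]
  refine Finset.card_equiv σ fun i => ?_
  simp

theorem exists_perm_of_mem_multislice {L N : ℕ} {κ : Fin L → ℕ} {x : Fin L → ℝ}
    {ω ω' : Fin N → ℝ} (hω : ω ∈ multislice L N κ x) (hω' : ω' ∈ multislice L N κ x) :
    ∃ σ : Equiv.Perm (Fin N), ω' = ω ∘ σ := by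
  simp only [multislice, Finset.mem_filter, Fintype.mem_piFinset] at hω hω'
  have hcard : ∀ c : ℝ, Fintype.card {i // ω' i = c} = Fintype.card {i // ω i = c} := by
    intro c
    rw [Fintype.card_subtype, Fintype.card_subtype]
    by_cases hc : c ∈ Finset.image x Finset.univ
    · obtain ⟨ℓ, -, rfl⟩ := Finset.mem_image.1 hc
      rw [hω.2 ℓ, hω'.2 ℓ]
    · have hne : ∀ η : Fin N → ℝ, (∀ i, η i ∈ Finset.image x Finset.univ) →
          Finset.univ.filter (fun i => η i = c) = ∅ := fun η hη =>
        Finset.filter_eq_empty_iff.2 fun i _ h => hc (h ▸ hη i)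
      rw [hne ω hω.1, hne ω' hω'.1]
  refine ⟨Equiv.ofFiberEquiv fun c => Fintype.equivOfCardEq (hcard c), ?_⟩
  funext i
  exact (Equiv.ofFiberEquiv_map _ i).symm

theorem uexpect_multislice {L N : ℕ} {κ : Fin L → ℕ} {x : Fin L → ℝ} {ω₀ : Fin N → ℝ}
    (hω₀ : ω₀ ∈ multislice L N κ x) (G : (Fin N → ℝ) → ℝ) :
    uexpect (multislice L N κ x) G =
      (∑ σ : Equiv.Perm (Fin N), G (ω₀ ∘ σ)) / N.factorial := by
  have hcard : (0 : ℝ) < (multislice L N κ x).card := by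
    exact_mod_cast Finset.card_pos.2 ⟨ω₀, hω₀⟩
  have hrow : ∀ ω ∈ multislice L N κ x,
      ∑ σ : Equiv.Perm (Fin N), G (ω ∘ σ) = ∑ σ : Equiv.Perm (Fin N), G (ω₀ ∘ σ) := by
    intro ω hω
    obtain ⟨τ, rfl⟩ := exists_perm_of_mem_multislice hω₀ hω
    rw [← Equiv.sum_comp (Equiv.mulLeft τ) fun σ : Equiv.Perm (Fin N) => G (ω₀ ∘ σ)]
    rfl
  have hcol : ∀ σ : Equiv.Perm (Fin N),
      ∑ ω ∈ multislice L N κ x, G (ω ∘ σ) = ∑ ω ∈ multislice L N κ x, G ω := by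
    intro σ
    refine Finset.sum_bij' (fun ω _ => ω ∘ σ) (fun ω _ => ω ∘ σ.symm)
      (fun ω hω => comp_perm_mem_multislice hω σ)
      (fun ω hω => comp_perm_mem_multislice hω σ.symm) ?_ ?_ ?_
    · intro ω _; funext i; simp
    · intro ω _; funext i; simp
    · intro ω _; rfl
  have hdouble : ((multislice L N κ x).card : ℝ) * ∑ σ : Equiv.Perm (Fin N), G (ω₀ ∘ σ) =
      N.factorial * ∑ ω ∈ multislice L N κ x, G ω := by
    rw [← nsmul_eq_mul, ← Finset.sum_const, ← Finset.sum_congr rfl hrow, Finset.sum_comm,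
      Finset.sum_congr rfl fun σ _ => hcol σ, Finset.sum_const, Finset.card_univ,
      Fintype.card_perm, Fintype.card_fin, nsmul_eq_mul]
  unfold uexpect
  rw [div_eq_div_iff hcard.ne' (by positivity)]
  linarith

theorem ConvexOn.fderiv_sub_le {E : Type*} [NormedAddCommGroup E] [NormedSpace ℝ E] {s : Set E}
    {f : E → ℝ} (hf : ConvexOn ℝ s f) {u v : E} (hu : u ∈ s) (hv : v ∈ s)
    (hd : DifferentiableAt ℝ f u) : fderiv ℝ f u (v - u) ≤ f v - f u := by
  have hconv : ConvexOn ℝ (AffineMap.lineMap u v ⁻¹' s) (f ∘ AffineMap.lineMap (k := ℝ) u v) :=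
    hf.comp_affineMap _
  have hderiv : HasDerivAt (f ∘ AffineMap.lineMap (k := ℝ) u v) (fderiv ℝ f u (v - u)) 0 := by
    have h1 : HasFDerivAt f (fderiv ℝ f u) (AffineMap.lineMap (k := ℝ) u v 0) := by
      simpa using hd.hasFDerivAt
    exact h1.comp_hasDerivAt 0 AffineMap.hasDerivAt_lineMap
  have h := hconv.le_slope_of_hasDerivAt (x := 0) (y := 1) (by simpa) (by simpa) one_pos hderiv
  simpa [slope_def_field] using h

theorem comp_swap_sub {N : ℕ} (ω : Fin N → ℝ) (a b : Fin N) :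
    ω ∘ Equiv.swap a b - ω =
      (ω b - ω a) • (Pi.single a (1 : ℝ) - Pi.single b 1 : Fin N → ℝ) := by
  funext i
  by_cases ha : i = a <;> by_cases hb : i = b
  · subst ha; subst hb; simp
  · subst ha; simp [hb]
  · subst hb; simp [ha]
  · simp [ha, hb, Equiv.swap_apply_of_ne_of_ne]

theorem logDiffProd_exp_le {s t A B : ℝ} (hA : 0 ≤ A) (hB : 0 ≤ B)
    (hst : t ≤ s → (s - t) ^ 2 ≤ A) (hts : s ≤ t → (t - s) ^ 2 ≤ B) :
    logDiffProd (Real.exp s) (Real.exp t) ≤ Real.exp s * A + Real.exp t * B := by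
  have key : ∀ u v C : ℝ, v ≤ u → (u - v) ^ 2 ≤ C →
      (Real.exp u - Real.exp v) * (u - v) ≤ Real.exp u * C := by
    intro u v C huv hC
    have h1 : Real.exp u - Real.exp v ≤ Real.exp u * (u - v) := by
      have h := mul_le_mul_of_nonneg_left (Real.add_one_le_exp (v - u)) (Real.exp_pos u).le
      rw [← Real.exp_add, add_sub_cancel] at h
      linarith
    calc _ ≤ Real.exp u * (u - v) * (u - v) :=
          mul_le_mul_of_nonneg_right h1 (sub_nonneg.2 huv)
      _ = Real.exp u * (u - v) ^ 2 := by ring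
      _ ≤ _ := mul_le_mul_of_nonneg_left hC (Real.exp_pos u).le
  have hsA : 0 ≤ Real.exp s * A := by positivity
  have htB : 0 ≤ Real.exp t * B := by positivity
  unfold logDiffProd
  rw [Real.log_exp, Real.log_exp]
  rcases le_total t s with h | h
  · linarith [key s t A h (hst h)]
  · linarith [key t s B h (hts h)]

theorem sum_sum_sub_sq_le {N : ℕ} (d : Fin N → ℝ) :
    ∑ a, ∑ b, (d a - d b) ^ 2 ≤ 2 * (N : ℝ) * ∑ i, d i ^ 2 := by
  have h : ∑ a, ∑ b, (d a - d b) ^ 2 = 2 * (N : ℝ) * ∑ i, d i ^ 2 - 2 * (∑ i, d i) ^ 2 := by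
    have e : ∀ a b, (d a - d b) ^ 2 = d a ^ 2 - 2 * d a * d b + d b ^ 2 := fun a b => by ring
    simp only [e, Finset.sum_add_distrib, Finset.sum_sub_distrib, ← Finset.mul_sum,
      ← Finset.sum_mul, Finset.sum_const, Finset.card_univ, Fintype.card_fin, nsmul_eq_mul]
    ring
  rw [h]
  nlinarith [sq_nonneg (∑ i, d i)]

/-- The decrease of a convex function under a transposition of coordinates is controlled by its
gradient. -/
theorem ConvexOn.sub_comp_swap_sq_le {N : ℕ} {m M : ℝ} {f : (Fin N → ℝ) → ℝ}
    (hf : ConvexOn ℝ (Set.univ.pi fun _ : Fin N => Set.Icc m M) f) (hd : Differentiable ℝ f)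
    {ω : Fin N → ℝ} (hω : ∀ i, ω i ∈ Set.Icc m M) (a b : Fin N)
    (hle : f (ω ∘ Equiv.swap a b) ≤ f ω) :
    (f ω - f (ω ∘ Equiv.swap a b)) ^ 2 ≤
      (M - m) ^ 2 * (fderiv ℝ f ω (Pi.single a 1) - fderiv ℝ f ω (Pi.single b 1)) ^ 2 := by
  have h := hf.fderiv_sub_le (u := ω) (v := ω ∘ Equiv.swap a b) (fun i _ => hω i)
    (fun i _ => hω _) (hd ω)
  rw [comp_swap_sub, map_smul, map_sub, smul_eq_mul] at h
  set δ := fderiv ℝ f ω (Pi.single a 1) - fderiv ℝ f ω (Pi.single b 1)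
  have hsq : (f ω - f (ω ∘ Equiv.swap a b)) ^ 2 ≤ ((ω a - ω b) * δ) ^ 2 :=
    pow_le_pow_left₀ (sub_nonneg.2 hle) (by linarith) 2
  have hrange : (ω a - ω b) ^ 2 ≤ (M - m) ^ 2 := by
    apply sq_le_sq'
    · linarith [(hω a).1, (hω b).2]
    · linarith [(hω a).2, (hω b).1]
  calc _ ≤ ((ω a - ω b) * δ) ^ 2 := hsq
    _ = (ω a - ω b) ^ 2 * δ ^ 2 := by ring
    _ ≤ _ := mul_le_mul_of_nonneg_right hrange (sq_nonneg _)

theorem sum_swapForm_exp_le {N : ℕ} {m M : ℝ} {f : (Fin N → ℝ) → ℝ}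
    (hf : ConvexOn ℝ (Set.univ.pi fun _ : Fin N => Set.Icc m M) f) (hd : Differentiable ℝ f)
    {ω : Fin N → ℝ} (hω : ∀ i, ω i ∈ Set.Icc m M) :
    ∑ a, ∑ b, swapForm (fun σ : Equiv.Perm (Fin N) => Real.exp (f (ω ∘ σ))) a b ≤
      4 * (N : ℝ) * (M - m) ^ 2 * ∑ σ : Equiv.Perm (Fin N),
        Real.exp (f (ω ∘ σ)) * ∑ i, (fderiv ℝ f (ω ∘ σ) (Pi.single i 1)) ^ 2 := by
  set δ : Equiv.Perm (Fin N) → Fin N → ℝ := fun σ i => fderiv ℝ f (ω ∘ σ) (Pi.single i 1)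
  have hswap : ∀ a b, swapForm (fun σ : Equiv.Perm (Fin N) => Real.exp (f (ω ∘ σ))) a b ≤
      2 * ∑ σ : Equiv.Perm (Fin N),
        Real.exp (f (ω ∘ σ)) * ((M - m) ^ 2 * (δ σ a - δ σ b) ^ 2) := by
    intro a b
    have hpt : ∀ σ : Equiv.Perm (Fin N),
        logDiffProd (Real.exp (f (ω ∘ σ))) (Real.exp (f (ω ∘ ⇑(σ * Equiv.swap a b)))) ≤
          Real.exp (f (ω ∘ σ)) * ((M - m) ^ 2 * (δ σ a - δ σ b) ^ 2) +
          Real.exp (f (ω ∘ ⇑(σ * Equiv.swap a b))) * ((M - m) ^ 2 *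
            (δ (σ * Equiv.swap a b) a - δ (σ * Equiv.swap a b) b) ^ 2) := by
      intro σ
      refine logDiffProd_exp_le (by positivity) (by positivity) (fun h => ?_) (fun h => ?_)
      · exact hf.sub_comp_swap_sq_le hd (ω := ω ∘ σ) (fun i => hω _) a b h
      · have hinv : (ω ∘ ⇑(σ * Equiv.swap a b)) ∘ Equiv.swap a b = ω ∘ σ := by
          funext i; simp
        have := hf.sub_comp_swap_sq_le hd (ω := ω ∘ ⇑(σ * Equiv.swap a b)) (fun i => hω _) a b
          (by rw [hinv]; exact h)
        rwa [hinv] at this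
    refine (Finset.sum_le_sum fun σ _ => hpt σ).trans (le_of_eq ?_)
    have hreindex := Equiv.sum_comp (Equiv.mulRight (Equiv.swap a b))
      fun σ : Equiv.Perm (Fin N) =>
        Real.exp (f (ω ∘ σ)) * ((M - m) ^ 2 * (δ σ a - δ σ b) ^ 2)
    simp only [Equiv.coe_mulRight] at hreindex
    rw [Finset.sum_add_distrib, hreindex, two_mul]
  calc _ ≤ ∑ a, ∑ b, 2 * ∑ σ : Equiv.Perm (Fin N),
        Real.exp (f (ω ∘ σ)) * ((M - m) ^ 2 * (δ σ a - δ σ b) ^ 2) :=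
        Finset.sum_le_sum fun a _ => Finset.sum_le_sum fun b _ => hswap a b
    _ = ∑ σ : Equiv.Perm (Fin N), 2 * (M - m) ^ 2 * Real.exp (f (ω ∘ σ)) *
          ∑ a, ∑ b, (δ σ a - δ σ b) ^ 2 := by
        simp only [Finset.mul_sum]
        rw [Finset.sum_congr rfl fun a _ => Finset.sum_comm, Finset.sum_comm]
        refine Finset.sum_congr rfl fun σ _ => Finset.sum_congr rfl fun a _ =>
          Finset.sum_congr rfl fun b _ => by ring
    _ ≤ ∑ σ : Equiv.Perm (Fin N), 2 * (M - m) ^ 2 * Real.exp (f (ω ∘ σ)) *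
          (2 * (N : ℝ) * ∑ i, δ σ i ^ 2) :=
        Finset.sum_le_sum fun σ _ =>
          mul_le_mul_of_nonneg_left (sum_sum_sub_sq_le _) (by positivity)
    _ = _ := by
        rw [Finset.mul_sum]
        exact Finset.sum_congr rfl fun σ _ => by ring

/-- Convex gradient modified log-Sobolev inequality for the multislice:
`Ent(e^f) ≤ 4|𝒳|² E[e^f |∇f|²]` for convex (differentiable) `f` on `[x_1, x_L]^N`. -/
theorem stmt15 (L N : ℕ) (hL : 2 ≤ L) (κ : Fin L → ℕ) (hκ : ∀ ℓ, 1 ≤ κ ℓ)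
    (hN : N = ∑ ℓ, κ ℓ) (x : Fin L → ℝ) (hx : StrictMono x)
    (f : (Fin N → ℝ) → ℝ)
    (hconv : ConvexOn ℝ (Set.univ.pi fun _ : Fin N =>
      Set.Icc (x ⟨0, by omega⟩) (x ⟨L - 1, by omega⟩)) f)
    (hdiff : Differentiable ℝ f) :
    uent (multislice L N κ x) (fun ω => Real.exp (f ω)) ≤
      4 * (x ⟨L - 1, by omega⟩ - x ⟨0, by omega⟩) ^ 2 *
        uexpect (multislice L N κ x)
          (fun ω => Real.exp (f ω) * ∑ i, (fderiv ℝ f ω (Pi.single i 1)) ^ 2) := by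
  rcases (multislice L N κ x).eq_empty_or_nonempty with hΩ | ⟨ω, hω⟩
  · simp [hΩ, uent, uexpect]
  have hbox : ∀ i, ω i ∈ Set.Icc (x ⟨0, by omega⟩) (x ⟨L - 1, by omega⟩) := by
    intro i
    simp only [multislice, Finset.mem_filter, Fintype.mem_piFinset] at hω
    obtain ⟨ℓ, -, hℓ⟩ := Finset.mem_image.1 (hω.1 i)
    rw [← hℓ]
    exact ⟨hx.monotone (Fin.mk_le_of_le_val (Nat.zero_le _)),
      hx.monotone (Fin.le_def.2 (Nat.le_sub_one_of_lt ℓ.2))⟩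
  have hent := entropy_perm_le_swapForm N
    (fun σ : Equiv.Perm (Fin N) => Real.exp (f (ω ∘ σ))) (fun _ => Real.exp_pos _)
  have hgrad := sum_swapForm_exp_le hconv hdiff hbox
  have hNpos : (0 : ℝ) < N := by
    have : 1 ≤ N := by
      rw [hN]
      exact (hκ ⟨0, by omega⟩).trans
        (Finset.single_le_sum (fun ℓ _ => Nat.zero_le (κ ℓ)) (Finset.mem_univ _))
    exact_mod_cast this
  unfold uent
  rw [uexpect_multislice hω, uexpect_multislice hω, uexpect_multislice hω]
  set R := (x ⟨L - 1, by omega⟩ - x ⟨0, by omega⟩) ^ 2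
  set W := ∑ σ : Equiv.Perm (Fin N),
    Real.exp (f (ω ∘ σ)) * ∑ i, (fderiv ℝ f (ω ∘ σ) (Pi.single i 1)) ^ 2
  have hRW : 0 ≤ R * W :=
    mul_nonneg (sq_nonneg _) (Finset.sum_nonneg fun σ _ =>
      mul_nonneg (Real.exp_pos _).le (Finset.sum_nonneg fun i _ => sq_nonneg _))
  have hfinal := hent.trans (mul_le_mul_of_nonneg_left hgrad (by positivity))
  have hsimp : 1 / (2 * (N : ℝ)) * (4 * (N : ℝ) * R * W) = 2 * (R * W) := by
    field_simp
    norm_num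
  rw [hsimp] at hfinal
  rw [div_mul_eq_mul_div, ← sub_div, ← mul_div_assoc]
  refine div_le_div_of_nonneg_right ?_ (by positivity)
  linarith
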